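/- arXiv:2505.18877 — 3 statements merged into one kernel-verified Lean document; each statement's English description precedes it below -/
import Mathlib

section
/- Let A ∈ ℝ^{m×r}, B ∈ ℝ^{n×r}, G ∈ ℝ^{m×n}, η ∈ ℝ, and let P ∈ ℝ^{r×r} be invertible. Set Ã := A·P and B̃ := B·P⁻ᵀ. Then the refactored weight update satisfies −η·Ã·Ãᵀ·G − η·G·B̃·B̃ᵀ + η²·G·B̃·Ãᵀ·G = −η·A·(P·Pᵀ)·Aᵀ·G − η·G·B·(P·Pᵀ)⁻¹·Bᵀ + η²·G·B·Aᵀ·G; in particular the update depends on P only through the symmetric positive definite matrix S := P·Pᵀ. -/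
open Matrix


theorem stmt2 {m n r : ℕ} (η : ℝ) (G : Matrix (Fin m) (Fin n) ℝ)
    (A : Matrix (Fin m) (Fin r) ℝ) (B : Matrix (Fin n) (Fin r) ℝ)
    (P : Matrix (Fin r) (Fin r) ℝ) (hP : IsUnit P.det) :
    -(η • ((A * P) * (A * P)ᵀ * G)) - η • (G * (B * (P⁻¹)ᵀ) * (B * (P⁻¹)ᵀ)ᵀ)
        + (η ^ 2) • (G * (B * (P⁻¹)ᵀ) * (A * P)ᵀ * G)
      = -(η • (A * (P * Pᵀ) * Aᵀ * G)) - η • (G * B * (P * Pᵀ)⁻¹ * Bᵀ)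
        + (η ^ 2) • (G * B * Aᵀ * G) := by
  have hInv : P⁻¹ᵀ * P⁻¹ = (P * Pᵀ)⁻¹ := by
    rw [Matrix.mul_inv_rev, transpose_nonsing_inv]
  have hCancel : P⁻¹ᵀ * Pᵀ = 1 := by
    rw [← transpose_mul, mul_nonsing_inv P hP, transpose_one]
  have hA : (A * P) * (A * P)ᵀ * G = A * (P * Pᵀ) * Aᵀ * G := by
    simp only [transpose_mul, Matrix.mul_assoc]
  have hB : G * (B * P⁻¹ᵀ) * (B * P⁻¹ᵀ)ᵀ = G * B * (P * Pᵀ)⁻¹ * Bᵀ := by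
    rw [← hInv]
    simp only [transpose_mul, transpose_transpose, Matrix.mul_assoc]
  have hBA : G * (B * P⁻¹ᵀ) * (A * P)ᵀ * G = G * B * Aᵀ * G := by
    calc G * (B * P⁻¹ᵀ) * (A * P)ᵀ * G = G * B * (P⁻¹ᵀ * Pᵀ) * Aᵀ * G := by
          simp only [transpose_mul, Matrix.mul_assoc]
      _ = G * B * Aᵀ * G := by rw [hCancel, Matrix.mul_one]
  rw [hA, hB, hBA]
end

section
/- Let ℓ : ℝ^{m×n} → ℝ be differentiable with L-Lipschitz gradient, L > 0. Fix W ∈ ℝ^{m×n}, set G := ∇ℓ(W), and fix η > 0, A ∈ ℝ^{m×r}, B ∈ ℝ^{n×r}. Then there exists a constant C ∈ ℝ (depending on ℓ, W, A, B, η, L but not on S) such that for every symmetric positive definite S ∈ ℝ^{r×r}: ℓ(W − η·A·S·Aᵀ·G − η·G·B·S⁻¹·Bᵀ + η²·G·B·Aᵀ·G) ≤ (L·η²/2)·‖G‖₂²·(tr(A·S·Aᵀ) + tr(B·S⁻¹·Bᵀ) − 1/(L·η))² + L·η³·‖G‖₂³·(‖A·S·Aᵀ‖_F + ‖B·S⁻¹·Bᵀ‖_F)·‖B·Aᵀ‖_F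 + C. -/
open Matrix

/-- Spectral (operator ℓ₂→ℓ₂) norm. -/
noncomputable def specNorm {m n : ℕ} (G : Matrix (Fin m) (Fin n) ℝ) : ℝ :=
  ‖LinearMap.toContinuousLinearMap (Matrix.toEuclideanLin G)‖



attribute [local instance]
  Matrix.frobeniusSeminormedAddCommGroup Matrix.frobeniusNormedAddCommGroup
  Matrix.frobeniusNormedSpace

/-- The continuous linear map `H ↦ ⟨G, H⟩_F = tr (Gᵀ H)`. -/
noncomputable def frobInnerCLM {m n : ℕ} (G : Matrix (Fin m) (Fin n) ℝ) :
    Matrix (Fin m) (Fin n) ℝ →L[ℝ] ℝ :=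
  LinearMap.toContinuousLinearMap
    { toFun := fun H => (Gᵀ * H).trace
      map_add' := fun X Y => by simp [Matrix.mul_add]
      map_smul' := fun c X => by simp [Matrix.mul_smul] }

theorem frobenius_norm_sq_eq_trace {m n : Type*} [Fintype m] [Fintype n] (X : Matrix m n ℝ) :
    ‖X‖ ^ 2 = (Xᵀ * X).trace := by
  rw [Matrix.frobenius_norm_def, ← Real.sqrt_eq_rpow, Real.sq_sqrt (by positivity),
    Finset.sum_comm]
  simp [Matrix.trace, Matrix.mul_apply, sq]

theorem trace_transpose_mul_comm {m n : Type*} [Fintype m] [Fintype n] (X Y : Matrix m n ℝ) :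
    (Xᵀ * Y).trace = (Yᵀ * X).trace := by
  rw [← Matrix.trace_transpose, Matrix.transpose_mul, Matrix.transpose_transpose]

theorem frobenius_norm_add_sq {m n : Type*} [Fintype m] [Fintype n] (X Y : Matrix m n ℝ) :
    ‖X + Y‖ ^ 2 = ‖X‖ ^ 2 + 2 * (Xᵀ * Y).trace + ‖Y‖ ^ 2 := by
  simp only [frobenius_norm_sq_eq_trace, Matrix.transpose_add, Matrix.add_mul, Matrix.mul_add,
    Matrix.trace_add, trace_transpose_mul_comm Y X]
  ring

/-- Cauchy–Schwarz for the Frobenius inner product. -/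
theorem trace_transpose_mul_le {m n : Type*} [Fintype m] [Fintype n] (X Y : Matrix m n ℝ) :
    (Xᵀ * Y).trace ≤ ‖X‖ * ‖Y‖ := by
  have h : ‖X + Y‖ ^ 2 ≤ (‖X‖ + ‖Y‖) ^ 2 := by
    gcongr
    exact norm_add_le X Y
  rw [frobenius_norm_add_sq] at h
  linarith

theorem specNorm_nonneg {m n : ℕ} (G : Matrix (Fin m) (Fin n) ℝ) : 0 ≤ specNorm G :=
  norm_nonneg _

theorem specNorm_transpose {m n : ℕ} (G : Matrix (Fin m) (Fin n) ℝ) :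
    specNorm Gᵀ = specNorm G := by
  have h := Matrix.l2_opNorm_conjTranspose G
  rw [Matrix.conjTranspose_eq_transpose_of_trivial] at h
  exact h

theorem frobenius_norm_mul_le_specNorm {m n k : ℕ} (G : Matrix (Fin m) (Fin n) ℝ)
    (Y : Matrix (Fin n) (Fin k) ℝ) : ‖G * Y‖ ≤ specNorm G * ‖Y‖ := by
  have hcol : ∀ {p : ℕ} (Z : Matrix (Fin p) (Fin k) ℝ),
      ‖Z‖ ^ 2 = ∑ j, ‖WithLp.toLp 2 (fun i => Z i j)‖ ^ 2 := by
    intro p Z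
    rw [frobenius_norm_sq_eq_trace]
    simp only [EuclideanSpace.norm_sq_eq]
    simp [Matrix.trace, Matrix.mul_apply, sq]
  refine le_of_sq_le_sq ?_ (mul_nonneg (specNorm_nonneg G) (norm_nonneg Y))
  rw [mul_pow, hcol, hcol, Finset.mul_sum]
  refine Finset.sum_le_sum fun j _ => ?_
  rw [← mul_pow]
  gcongr
  exact (LinearMap.toContinuousLinearMap (Matrix.toEuclideanLin G)).le_opNorm
    (WithLp.toLp 2 (fun i => Y i j))

theorem frobenius_norm_mul_le_mul_specNorm {m n k : ℕ} (Y : Matrix (Fin k) (Fin m) ℝ)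
    (G : Matrix (Fin m) (Fin n) ℝ) : ‖Y * G‖ ≤ ‖Y‖ * specNorm G := by
  rw [← Matrix.frobenius_norm_transpose (Y * G), Matrix.transpose_mul,
    ← Matrix.frobenius_norm_transpose Y, ← specNorm_transpose G, mul_comm]
  exact frobenius_norm_mul_le_specNorm _ _

/-- The operator `X ↦ RᵀR X + X TᵀT` is positive semidefinite with norm at most
`‖R‖² + ‖T‖²`, so its square is dominated by this multiple of itself. -/
theorem norm_sq_gram_mul_add_mul_gram_le {k l m n : Type*} [Fintype k] [Fintype l] [Fintype m]
    [Fintype n] (R : Matrix k m ℝ) (T : Matrix l n ℝ) (G : Matrix m n ℝ) :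
    ‖Rᵀ * R * G + G * (Tᵀ * T)‖ ^ 2
      ≤ (‖R‖ ^ 2 + ‖T‖ ^ 2) * (‖R * G‖ ^ 2 + ‖G * Tᵀ‖ ^ 2) := by
  have hcross : ((Rᵀ * R * G)ᵀ * (G * (Tᵀ * T))).trace = ‖R * G * Tᵀ‖ ^ 2 := by
    rw [frobenius_norm_sq_eq_trace]
    simp only [Matrix.transpose_mul, Matrix.transpose_transpose, Matrix.mul_assoc]
    rw [Matrix.trace_mul_comm T]
    simp only [Matrix.mul_assoc]
  have hleft : ‖Rᵀ * R * G‖ ≤ ‖R‖ * ‖R * G‖ := by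
    rw [Matrix.mul_assoc, ← Matrix.frobenius_norm_transpose R]
    exact Matrix.frobenius_norm_mul _ _
  have hright : ‖G * (Tᵀ * T)‖ ≤ ‖G * Tᵀ‖ * ‖T‖ := by
    rw [← Matrix.mul_assoc]
    exact Matrix.frobenius_norm_mul _ _
  have hmid : ‖R * G * Tᵀ‖ ≤ ‖R * G‖ * ‖T‖ := by
    rw [← Matrix.frobenius_norm_transpose T]
    exact Matrix.frobenius_norm_mul _ _
  have hmid' : ‖R * G * Tᵀ‖ ≤ ‖R‖ * ‖G * Tᵀ‖ := by
    rw [Matrix.mul_assoc]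
    exact Matrix.frobenius_norm_mul _ _
  rw [frobenius_norm_add_sq, hcross]
  calc _ ≤ (‖R‖ * ‖R * G‖) ^ 2 + ((‖R * G‖ * ‖T‖) ^ 2 + (‖R‖ * ‖G * Tᵀ‖) ^ 2)
          + (‖G * Tᵀ‖ * ‖T‖) ^ 2 := by
        rw [two_mul]
        gcongr
    _ = _ := by ring

theorem trace_transpose_mul_gram_mul_add {k l m n : Type*} [Fintype k] [Fintype l] [Fintype m]
    [Fintype n] (R : Matrix k m ℝ) (T : Matrix l n ℝ) (G : Matrix m n ℝ) :
    (Gᵀ * (Rᵀ * R * G + G * (Tᵀ * T))).trace = ‖R * G‖ ^ 2 + ‖G * Tᵀ‖ ^ 2 := by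
  rw [frobenius_norm_sq_eq_trace, frobenius_norm_sq_eq_trace, Matrix.mul_add, Matrix.trace_add]
  simp only [Matrix.transpose_mul, Matrix.transpose_transpose, Matrix.mul_assoc]
  rw [Matrix.trace_mul_comm T]
  simp only [Matrix.mul_assoc]

/-- The descent lemma for a function with Lipschitz gradient. -/
theorem le_add_trace_add_of_lipschitz_grad {m n : ℕ} {L : ℝ}
    {ℓ : Matrix (Fin m) (Fin n) ℝ → ℝ}
    {grad : Matrix (Fin m) (Fin n) ℝ → Matrix (Fin m) (Fin n) ℝ}
    (hdiff : ∀ W, HasFDerivAt ℓ (frobInnerCLM (grad W)) W)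
    (hlip : ∀ W W', ‖grad W - grad W'‖ ≤ L * ‖W - W'‖)
    (W D : Matrix (Fin m) (Fin n) ℝ) :
    ℓ (W + D) ≤ ℓ W + ((grad W)ᵀ * D).trace + L / 2 * ‖D‖ ^ 2 := by
  let φ : ℝ → ℝ := fun s =>
    ℓ (W + s • D) - (s * ((grad W)ᵀ * D).trace + s ^ 2 * (L / 2 * ‖D‖ ^ 2))
  have hφ : ∀ s, HasDerivAt φ (((grad (W + s • D))ᵀ * D).trace
      - (((grad W)ᵀ * D).trace + 2 * s * (L / 2 * ‖D‖ ^ 2))) s := by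
    intro s
    have hline : HasDerivAt (fun s : ℝ => W + s • D) D s := by
      have h := ((hasDerivAt_id s).smul_const D).const_add W
      rw [one_smul] at h
      exact h
    have h₁ : HasDerivAt (fun s : ℝ => ℓ (W + s • D)) (((grad (W + s • D))ᵀ * D).trace) s :=
      HasFDerivAt.comp_hasDerivAt (l := ℓ) (l' := frobInnerCLM (grad (W + s • D))) s
        (hdiff (W + s • D)) hline
    have h₂ : HasDerivAt (fun s : ℝ => s * ((grad W)ᵀ * D).trace)
        (((grad W)ᵀ * D).trace) s := by
      simpa using (hasDerivAt_id s).mul_const ((grad W)ᵀ * D).trace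
    have h₃ : HasDerivAt (fun s : ℝ => s ^ 2 * (L / 2 * ‖D‖ ^ 2))
        (2 * s * (L / 2 * ‖D‖ ^ 2)) s := by
      simpa using (hasDerivAt_pow 2 s).mul_const (L / 2 * ‖D‖ ^ 2)
    exact h₁.sub (h₂.add h₃)
  have hanti : AntitoneOn φ (Set.Icc 0 1) := by
    refine antitoneOn_of_deriv_nonpos (convex_Icc 0 1)
      (fun s _ => (hφ s).continuousAt.continuousWithinAt)
      (fun s _ => (hφ s).differentiableAt.differentiableWithinAt) fun s hs => ?_
    rw [interior_Icc] at hs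
    have hcs := trace_transpose_mul_le (grad (W + s • D) - grad W) D
    have hl := hlip (W + s • D) W
    rw [add_sub_cancel_left, norm_smul, Real.norm_eq_abs, abs_of_pos hs.1] at hl
    have hmul := mul_le_mul_of_nonneg_right hl (norm_nonneg D)
    rw [Matrix.transpose_sub, Matrix.sub_mul, Matrix.trace_sub] at hcs
    rw [(hφ s).deriv]
    linarith
  have h := hanti (by simp) (by simp) zero_le_one
  simp only [φ, one_smul, zero_smul, add_zero] at h
  linarith

open scoped MatrixOrder in
theorem Matrix.PosSemidef.exists_eq_transpose_mul_self {n : Type*} [Fintype n] [DecidableEq n]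
    {S : Matrix n n ℝ} (hS : S.PosSemidef) : ∃ K : Matrix n n ℝ, S = Kᵀ * K := by
  obtain ⟨K, hK⟩ := CStarAlgebra.nonneg_iff_eq_star_mul_self.mp hS.nonneg
  refine ⟨K, ?_⟩
  rwa [Matrix.star_eq_conjTranspose, Matrix.conjTranspose_eq_transpose_of_trivial] at hK

theorem mul_sub_le_mul_sq_sub {L η σ t x y : ℝ} (hL : 0 < L) (hη : 0 < η) (ht : 0 ≤ t)
    (hx : 0 ≤ x) (hxt : x ≤ σ ^ 2 * t) (hy : y ≤ t * x) :
    L * η ^ 2 / 2 * y - η * x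
      ≤ L * η ^ 2 / 2 * σ ^ 2 * (t - 1 / (L * η)) ^ 2 + 2 * σ ^ 2 / L := by
  have hsq : L * η ^ 2 / 2 * σ ^ 2 * (t - 1 / (L * η)) ^ 2
      = L * η ^ 2 / 2 * σ ^ 2 * t ^ 2 - η * σ ^ 2 * t + σ ^ 2 / (2 * L) := by
    field_simp
    ring
  have hy' : L * η ^ 2 / 2 * y ≤ L * η ^ 2 / 2 * (t * x) := by gcongr
  have hpos : 0 ≤ σ ^ 2 / (2 * L) := by positivity
  have hpos' : 0 ≤ 2 * σ ^ 2 / L := by positivity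
  suffices h : 0 ≤ (σ ^ 2 * t - x) * (L * η ^ 2 / 2 * t - η) + 2 * σ ^ 2 / L by
    rw [hsq]
    linarith
  by_cases hbig : η ≤ L * η ^ 2 / 2 * t
  · have := mul_nonneg (sub_nonneg.2 hxt) (sub_nonneg.2 hbig)
    linarith
  · have hηt : η * t ≤ 2 / L := by
      rw [le_div_iff₀ hL]
      by_contra! hcon
      exact hbig (by nlinarith)
    have h₁ : σ ^ 2 * (η * t) ≤ σ ^ 2 * (2 / L) := by gcongr
    have h₂ : 0 ≤ (σ ^ 2 * t - x) * (L * η ^ 2 / 2 * t) :=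
      mul_nonneg (sub_nonneg.2 hxt) (by positivity)
    have h₃ : 0 ≤ x * η := by positivity
    have h₄ : σ ^ 2 * (2 / L) = 2 * σ ^ 2 / L := by ring
    linarith

theorem stmt3 {m n r : ℕ} (L : ℝ) (hL : 0 < L)
    (ℓ : Matrix (Fin m) (Fin n) ℝ → ℝ)
    (grad : Matrix (Fin m) (Fin n) ℝ → Matrix (Fin m) (Fin n) ℝ)
    (hdiff : ∀ W, HasFDerivAt ℓ (frobInnerCLM (grad W)) W)
    (hlip : ∀ W W', ‖grad W - grad W'‖ ≤ L * ‖W - W'‖)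
    (W : Matrix (Fin m) (Fin n) ℝ) (η : ℝ) (hη : 0 < η)
    (A : Matrix (Fin m) (Fin r) ℝ) (B : Matrix (Fin n) (Fin r) ℝ) :
    ∃ C : ℝ, ∀ S : Matrix (Fin r) (Fin r) ℝ, S.PosDef →
      ℓ (W - η • (A * S * Aᵀ * grad W) - η • (grad W * B * S⁻¹ * Bᵀ)
          + (η ^ 2) • (grad W * B * Aᵀ * grad W))
        ≤ (L * η ^ 2 / 2) * specNorm (grad W) ^ 2 *
            ((A * S * Aᵀ).trace + (B * S⁻¹ * Bᵀ).trace - 1 / (L * η)) ^ 2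
          + L * η ^ 3 * specNorm (grad W) ^ 3 *
            (‖A * S * Aᵀ‖ + ‖B * S⁻¹ * Bᵀ‖) * ‖B * Aᵀ‖ + C := by
  set G := grad W with hG
  set σ := specNorm G
  set N := G * B * Aᵀ * G with hN
  have hσ : 0 ≤ σ := specNorm_nonneg G
  refine ⟨ℓ W + η ^ 2 * (Gᵀ * N).trace + L / 2 * η ^ 4 * ‖N‖ ^ 2 + 2 * σ ^ 2 / L,
    fun S hS => ?_⟩
  obtain ⟨K, hK⟩ := hS.posSemidef.exists_eq_transpose_mul_self
  obtain ⟨J, hJ⟩ := hS.inv.posSemidef.exists_eq_transpose_mul_self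
  obtain ⟨R, hR⟩ : ∃ R, R = K * Aᵀ := ⟨_, rfl⟩
  obtain ⟨T, hT⟩ : ∃ T, T = J * Bᵀ := ⟨_, rfl⟩
  have hP : A * S * Aᵀ = Rᵀ * R := by simp [hR, hK, Matrix.mul_assoc]
  have hQ : B * S⁻¹ * Bᵀ = Tᵀ * T := by simp [hT, hJ, Matrix.mul_assoc]
  have hGQ : G * B * S⁻¹ * Bᵀ = G * (Tᵀ * T) := by rw [← hQ]; simp only [Matrix.mul_assoc]
  rw [hGQ, hP, hQ, ← frobenius_norm_sq_eq_trace, ← frobenius_norm_sq_eq_trace]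
  obtain ⟨M, hM⟩ : ∃ M, M = Rᵀ * R * G + G * (Tᵀ * T) := ⟨_, rfl⟩
  have harg : W - η • (Rᵀ * R * G) - η • (G * (Tᵀ * T)) + η ^ 2 • N
      = W + ((-η) • M + η ^ 2 • N) := by
    rw [hM]
    module
  have hdesc := le_add_trace_add_of_lipschitz_grad hdiff hlip W ((-η) • M + η ^ 2 • N)
  rw [← harg, ← hG, frobenius_norm_add_sq, norm_smul, norm_smul, mul_pow, mul_pow] at hdesc
  simp only [Matrix.mul_add, Matrix.trace_add, Matrix.transpose_smul, Matrix.smul_mul,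
    Matrix.mul_smul, Matrix.trace_smul, smul_eq_mul, Real.norm_eq_abs, sq_abs] at hdesc
  have hGM : (Gᵀ * M).trace = ‖R * G‖ ^ 2 + ‖G * Tᵀ‖ ^ 2 := by
    rw [hM, trace_transpose_mul_gram_mul_add]
  have hMsq : ‖M‖ ^ 2 ≤ (‖R‖ ^ 2 + ‖T‖ ^ 2) * (‖R * G‖ ^ 2 + ‖G * Tᵀ‖ ^ 2) := by
    rw [hM]
    exact norm_sq_gram_mul_add_mul_gram_le R T G
  have hx : ‖R * G‖ ^ 2 + ‖G * Tᵀ‖ ^ 2 ≤ σ ^ 2 * (‖R‖ ^ 2 + ‖T‖ ^ 2) := by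
    have h₁ : ‖R * G‖ ≤ ‖R‖ * σ := frobenius_norm_mul_le_mul_specNorm R G
    have h₂ : ‖G * Tᵀ‖ ≤ σ * ‖T‖ := by
      rw [← Matrix.frobenius_norm_transpose T]
      exact frobenius_norm_mul_le_specNorm G Tᵀ
    calc _ ≤ (‖R‖ * σ) ^ 2 + (σ * ‖T‖) ^ 2 := by gcongr
      _ = _ := by ring
  have hmain := mul_sub_le_mul_sq_sub hL hη (by positivity) (by positivity) hx hMsq
  have hMle : ‖M‖ ≤ σ * (‖Rᵀ * R‖ + ‖Tᵀ * T‖) := by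
    have h₁ : ‖Rᵀ * R * G‖ ≤ ‖Rᵀ * R‖ * σ := frobenius_norm_mul_le_mul_specNorm _ G
    have h₂ : ‖G * (Tᵀ * T)‖ ≤ σ * ‖Tᵀ * T‖ := frobenius_norm_mul_le_specNorm G _
    have h₃ := norm_add_le (Rᵀ * R * G) (G * (Tᵀ * T))
    rw [hM]
    linarith
  have hNle : ‖N‖ ≤ σ ^ 2 * ‖B * Aᵀ‖ := by
    have h₁ : ‖N‖ ≤ ‖G * (B * Aᵀ)‖ * σ := by
      rw [hN, Matrix.mul_assoc G B Aᵀ]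
      exact frobenius_norm_mul_le_mul_specNorm _ G
    have h₂ : ‖G * (B * Aᵀ)‖ ≤ σ * ‖B * Aᵀ‖ := frobenius_norm_mul_le_specNorm G _
    calc _ ≤ _ := h₁
      _ ≤ σ * ‖B * Aᵀ‖ * σ := by gcongr
      _ = _ := by ring
  have hcross : -(Mᵀ * N).trace ≤ σ ^ 3 * (‖Rᵀ * R‖ + ‖Tᵀ * T‖) * ‖B * Aᵀ‖ := by
    have h := trace_transpose_mul_le (-M) N
    rw [Matrix.transpose_neg, Matrix.neg_mul, Matrix.trace_neg, norm_neg] at h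
    calc _ ≤ _ := h
      _ ≤ σ * (‖Rᵀ * R‖ + ‖Tᵀ * T‖) * (σ ^ 2 * ‖B * Aᵀ‖) := by gcongr
      _ = _ := by ring
  have hcross' := mul_le_mul_of_nonneg_left hcross (by positivity : 0 ≤ L * η ^ 3)
  rw [hGM] at hdesc
  linarith
end

section
/- Let A ∈ ℝ^{m×r} and B ∈ ℝ^{n×r} be nonzero, let L > 0, and let η ∈ ℝ with η ≠ 0 satisfy either η ≥ 1/(2·‖A‖_F·‖B‖_F·L) or η < 0. Then s* = ‖B‖_F / ‖A‖_F is the unique global minimizer over s ∈ (0, ∞) of the function h(s) := (‖A‖_F²·s + ‖B‖_F²·s⁻¹ − 1/(L·η))². -/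
open Matrix

/-- Frobenius norm. -/
noncomputable def frobNorm {m n : ℕ} (X : Matrix (Fin m) (Fin n) ℝ) : ℝ :=
  Real.sqrt ((Xᵀ * X).trace)


theorem frobNorm_pos {m n : ℕ} {X : Matrix (Fin m) (Fin n) ℝ} (hX : X ≠ 0) :
    0 < frobNorm X := by
  rw [frobNorm, Real.sqrt_pos, ← conjTranspose_eq_transpose_of_trivial]
  exact lt_of_le_of_ne (posSemidef_conjTranspose_mul_self X).trace_nonneg
    fun h => hX (trace_conjTranspose_mul_self_eq_zero_iff.mp h.symm)

theorem sq_mul_add_sq_mul_inv_eq {a b s : ℝ} (hs : s ≠ 0) :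
    a ^ 2 * s + b ^ 2 * s⁻¹ = 2 * a * b + (a * s - b) ^ 2 / s := by
  field_simp
  ring

theorem sq_mul_div_add_sq_mul_inv_div {a b : ℝ} (ha : a ≠ 0) (hb : b ≠ 0) :
    a ^ 2 * (b / a) + b ^ 2 * (b / a)⁻¹ = 2 * a * b := by
  field_simp
  ring

theorem stmt11 {m n r : ℕ}
    (A : Matrix (Fin m) (Fin r) ℝ) (B : Matrix (Fin n) (Fin r) ℝ)
    (hA : A ≠ 0) (hB : B ≠ 0) (L η : ℝ) (hL : 0 < L) (hη : η ≠ 0)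
    (hcase : 1 / (2 * frobNorm A * frobNorm B * L) ≤ η ∨ η < 0) :
    (∀ s : ℝ, 0 < s →
      (frobNorm A ^ 2 * (frobNorm B / frobNorm A)
          + frobNorm B ^ 2 * (frobNorm B / frobNorm A)⁻¹ - 1 / (L * η)) ^ 2
        ≤ (frobNorm A ^ 2 * s + frobNorm B ^ 2 * s⁻¹ - 1 / (L * η)) ^ 2) ∧
    ∀ s : ℝ, 0 < s →
      (frobNorm A ^ 2 * s + frobNorm B ^ 2 * s⁻¹ - 1 / (L * η)) ^ 2
        = (frobNorm A ^ 2 * (frobNorm B / frobNorm A)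
            + frobNorm B ^ 2 * (frobNorm B / frobNorm A)⁻¹ - 1 / (L * η)) ^ 2 →
      s = frobNorm B / frobNorm A := by
  have ha := frobNorm_pos hA
  have hb := frobNorm_pos hB
  generalize frobNorm A = a at *
  generalize frobNorm B = b at *
  have hc : 1 / (L * η) ≤ 2 * a * b := by
    rcases hcase with h | h
    · have hη' : 0 < η := lt_of_lt_of_le (by positivity) h
      rw [div_le_iff₀ (by positivity)] at h ⊢
      linarith
    · exact (div_nonpos_of_nonneg_of_nonpos zero_le_one
        (mul_nonpos_of_nonneg_of_nonpos hL.le h.le)).trans (by positivity)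
  rw [sq_mul_div_add_sq_mul_inv_div ha.ne' hb.ne']
  refine ⟨fun s hs => ?_, fun s hs h => ?_⟩
  · rw [sq_mul_add_sq_mul_inv_eq hs.ne']
    have hd : 0 ≤ (a * s - b) ^ 2 / s := by positivity
    exact pow_le_pow_left₀ (by linarith) (by linarith) 2
  · rw [sq_mul_add_sq_mul_inv_eq hs.ne'] at h
    have hd : 0 ≤ (a * s - b) ^ 2 / s := by positivity
    have h0 := (pow_left_inj₀ (by linarith) (by linarith) two_ne_zero).mp h
    have h1 : (a * s - b) ^ 2 / s = 0 := by linarith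
    have h2 : a * s - b = 0 := by simpa [hs.ne'] using h1
    rw [eq_div_iff ha.ne']
    linarith
end
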